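/- For every N ∈ ℕ, the N×N matrix Ĥ_N with entries (Ĥ_N)_{kℓ} = (1/2)∫_{−1}^1 x^{k+ℓ} dx (k,ℓ ∈ {0,…,N−1}) is positive definite, hence invertible, and there exists a constant C > 0 (independent of N) such that ‖Ĥ_N^{−1}‖₂ ≤ C (1+√2)^{2N} for all N ∈ ℕ. -/

import Mathlib

/-- The `N × N` section of the infinite EDMD Gram matrix for monomial
observables, `(Ĥ_N)_{kℓ} = (1/2)∫_{-1}^1 x^{k+ℓ} dx`. -/
noncomputable def HmatN (N : ℕ) : Matrix (Fin N) (Fin N) ℝ :=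
  Matrix.of fun k l => 1 / 2 * ∫ x in (-1 : ℝ)..1, x ^ ((k : ℕ) + (l : ℕ))

open Polynomial Polynomial.Chebyshev

/-- The integral of `cos (m θ)` over `[0, π]` vanishes for every nonzero integer `m`. -/
theorem integral_cos_intCast_mul (m : ℤ) :
    ∫ θ in (0 : ℝ)..Real.pi, Real.cos (m * θ) = if m = 0 then Real.pi else 0 := by
  split_ifs with hm
  · simp [hm]
  · have hm' : (m : ℝ) ≠ 0 := Int.cast_ne_zero.mpr hm
    rw [intervalIntegral.integral_comp_mul_left _ hm']
    simp [Real.sin_int_mul_pi]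

/-- The functions `sin ((j + 1) θ)` are orthogonal on `[0, π]`. -/
theorem integral_sin_mul_sin (j k : ℕ) :
    ∫ θ in (0 : ℝ)..Real.pi, Real.sin ((j + 1) * θ) * Real.sin ((k + 1) * θ) =
      if j = k then Real.pi / 2 else 0 := by
  have h : ∀ θ : ℝ, Real.sin ((j + 1) * θ) * Real.sin ((k + 1) * θ) =
      2⁻¹ * (Real.cos (((j - k : ℤ) : ℝ) * θ) - Real.cos (((j + k + 2 : ℤ) : ℝ) * θ)) := by
    intro θ
    have h1 : ((j - k : ℤ) : ℝ) * θ = (j + 1) * θ - (k + 1) * θ := by push_cast; ring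
    have h2 : ((j + k + 2 : ℤ) : ℝ) * θ = (j + 1) * θ + (k + 1) * θ := by push_cast; ring
    rw [h1, h2, Real.cos_sub, Real.cos_add]
    ring
  simp_rw [h]
  rw [intervalIntegral.integral_const_mul, intervalIntegral.integral_sub
    (Continuous.intervalIntegrable (by fun_prop) _ _)
    (Continuous.intervalIntegrable (by fun_prop) _ _),
    integral_cos_intCast_mul, integral_cos_intCast_mul,
    if_neg (show (j + k + 2 : ℤ) ≠ 0 by omega)]
  by_cases hjk : j = k
  · simp [hjk]; ring
  · rw [if_neg (by omega), if_neg hjk]; simp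

/-- Parseval's identity for finite sine sums on `[0, π]`. -/
theorem integral_sum_sin_sq (N : ℕ) (b : ℕ → ℝ) :
    ∫ θ in (0 : ℝ)..Real.pi, (∑ j ∈ Finset.range N, b j * Real.sin ((j + 1) * θ)) ^ 2 =
      Real.pi / 2 * ∑ j ∈ Finset.range N, b j ^ 2 := by
  have h : ∀ θ : ℝ, (∑ j ∈ Finset.range N, b j * Real.sin ((j + 1) * θ)) ^ 2 =
      ∑ j ∈ Finset.range N, ∑ k ∈ Finset.range N,
        b j * b k * (Real.sin ((j + 1) * θ) * Real.sin ((k + 1) * θ)) := by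
    intro θ
    rw [sq, Finset.sum_mul_sum]
    exact Finset.sum_congr rfl fun j _ => Finset.sum_congr rfl fun k _ => by ring
  simp_rw [h]
  rw [intervalIntegral.integral_finsetSum
    fun j _ => Continuous.intervalIntegrable (by fun_prop) _ _, Finset.mul_sum]
  refine Finset.sum_congr rfl fun j hj => ?_
  rw [intervalIntegral.integral_finsetSum
    fun k _ => Continuous.intervalIntegrable (by fun_prop) _ _]
  simp_rw [intervalIntegral.integral_const_mul, integral_sin_mul_sin]
  simp only [mul_ite, mul_zero, Finset.sum_ite_eq, hj, if_true]
  ring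

/-- The unweighted `L²` norm on `[-1, 1]` dominates the norm of the coefficients with respect to
the Chebyshev polynomials of the second kind. -/
theorem sum_sq_le_integral_sum_U_sq (N : ℕ) (b : ℕ → ℝ) :
    Real.pi / 2 * ∑ j ∈ Finset.range N, b j ^ 2 ≤
      ∫ x in (-1 : ℝ)..1, ((∑ j ∈ Finset.range N, C (b j) * U ℝ (j : ℤ)).eval x) ^ 2 := by
  set p : ℝ[X] := ∑ j ∈ Finset.range N, C (b j) * U ℝ (j : ℤ) with hp
  have hsubst : ∫ x in (-1 : ℝ)..1, (p.eval x) ^ 2 =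
      ∫ θ in (0 : ℝ)..Real.pi, (p.eval (Real.cos θ)) ^ 2 * Real.sin θ := by
    have := intervalIntegral.integral_comp_mul_deriv (a := 0) (b := Real.pi) (f := Real.cos)
      (f' := fun θ => -Real.sin θ) (g := fun x => (p.eval x) ^ 2)
      (fun x _ => Real.hasDerivAt_cos x) (by fun_prop) (by fun_prop)
    rw [Real.cos_zero, Real.cos_pi, intervalIntegral.integral_symm (-1) 1] at this
    simp only [Function.comp_apply, mul_neg, intervalIntegral.integral_neg] at this
    linarith
  rw [hsubst, ← integral_sum_sin_sq]
  refine intervalIntegral.integral_mono_on Real.pi_pos.le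
    (Continuous.intervalIntegrable (by fun_prop) _ _)
    (Continuous.intervalIntegrable (by fun_prop) _ _) fun θ hθ => ?_
  have hs : ∑ j ∈ Finset.range N, b j * Real.sin ((j + 1) * θ) =
      p.eval (Real.cos θ) * Real.sin θ := by
    rw [hp, eval_finsetSum, Finset.sum_mul]
    refine Finset.sum_congr rfl fun j _ => ?_
    have := U_real_cos θ (j : ℤ)
    push_cast at this
    rw [eval_mul, eval_C, mul_assoc, this]
  have h0 : 0 ≤ Real.sin θ := Real.sin_nonneg_of_mem_Icc hθ
  rw [hs, mul_pow]
  gcongr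
  nlinarith [Real.sin_le_one θ]

/-- Every polynomial of degree less than `N` is a combination of `U₀, …, U_{N-1}`. -/
theorem exists_eq_sum_U (N : ℕ) (p : ℝ[X]) (hp : p.degree < N) :
    ∃ b : ℕ → ℝ, p = ∑ j ∈ Finset.range N, C (b j) * U ℝ (j : ℤ) := by
  induction N generalizing p with
  | zero => exact ⟨0, by simpa using hp⟩
  | succ n ih =>
    have hlead : (U ℝ (n : ℤ)).coeff n = 2 ^ n := by
      rw [← leadingCoeff_U_natCast ℝ n, leadingCoeff, natDegree_U_natCast]
    set a : ℝ := p.coeff n / 2 ^ n with ha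
    obtain ⟨b, hb⟩ := ih (p - C a * U ℝ (n : ℤ)) (by
      rw [degree_lt_iff_coeff_zero] at hp ⊢
      intro m hm
      rw [coeff_sub, coeff_C_mul]
      rcases hm.eq_or_lt with rfl | hm
      · rw [hlead, ha]; field_simp; simp
      · rw [hp m hm, coeff_eq_zero_of_natDegree_lt (by rwa [natDegree_U_natCast])]
        simp)
    refine ⟨fun j => if j = n then a else b j, ?_⟩
    simp only [Finset.sum_range_succ, if_true]
    rw [Finset.sum_congr rfl (g := fun j : ℕ =>
      C (b j) * U ℝ (j : ℤ)) fun j hj => by rw [if_neg (Finset.mem_range.mp hj).ne], ← hb]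
    ring

theorem sum_abs_coeff_X_mul_le (M : ℕ) (q : ℝ[X]) :
    ∑ k ∈ Finset.range M, |(X * q).coeff k| ≤ ∑ k ∈ Finset.range M, |q.coeff k| := by
  cases M with
  | zero => simp
  | succ m =>
    rw [Finset.sum_range_succ', Finset.sum_range_succ]
    simp [coeff_X_mul]

/-- The sum of the absolute values of the coefficients of `Uⱼ` is at most `(1 + √2)ʲ`. -/
theorem sum_abs_coeff_U_le (M j : ℕ) :
    ∑ k ∈ Finset.range M, |(U ℝ (j : ℤ)).coeff k| ≤ (1 + Real.sqrt 2) ^ j := by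
  have h1 : ∑ k ∈ Finset.range M, |(1 : ℝ[X]).coeff k| ≤ 1 := by
    simp only [coeff_one, apply_ite abs, abs_one, abs_zero, Finset.sum_ite_eq']
    split_ifs <;> norm_num
  have hr : (1 + Real.sqrt 2) ^ 2 = 2 * (1 + Real.sqrt 2) + 1 := by
    have := Real.sq_sqrt (show (0 : ℝ) ≤ 2 by norm_num)
    nlinarith
  induction j using Nat.twoStepInduction with
  | zero => simpa using h1
  | one =>
    have h2 : (1 : ℝ) ≤ Real.sqrt 2 := by rw [Real.one_le_sqrt]; norm_num
    have hX := sum_abs_coeff_X_mul_le M (1 : ℝ[X])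
    have hU : ∀ k, |(U ℝ ((1 : ℕ) : ℤ)).coeff k| = 2 * |(X * (1 : ℝ[X])).coeff k| := by
      intro k
      rw [Nat.cast_one, U_one, mul_one, ← C_ofNat, coeff_C_mul, abs_mul]
      norm_num
    simp_rw [hU, ← Finset.mul_sum]
    linarith
  | more n ih0 ih1 =>
    have hU : ∀ k, |(U ℝ ((n + 2 : ℕ) : ℤ)).coeff k| ≤
        2 * |(X * U ℝ ((n + 1 : ℕ) : ℤ)).coeff k| + |(U ℝ (n : ℤ)).coeff k| := by
      intro k
      push_cast
      rw [U_add_two, mul_assoc, ← C_ofNat, coeff_sub, coeff_C_mul]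
      refine (abs_sub _ _).trans ?_
      rw [abs_mul, abs_two]
    have hX := sum_abs_coeff_X_mul_le M (U ℝ ((n + 1 : ℕ) : ℤ))
    calc _ ≤ ∑ k ∈ Finset.range M, (2 * |(X * U ℝ ((n + 1 : ℕ) : ℤ)).coeff k| +
            |(U ℝ (n : ℤ)).coeff k|) := Finset.sum_le_sum fun k _ => hU k
      _ ≤ 2 * (1 + Real.sqrt 2) ^ (n + 1) + (1 + Real.sqrt 2) ^ n := by
        rw [Finset.sum_add_distrib, ← Finset.mul_sum]; linarith
      _ = (1 + Real.sqrt 2) ^ (n + 2) := by rw [pow_add _ n 2, hr]; ring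

theorem sum_pow_le (N : ℕ) :
    ∑ j ∈ Finset.range N, (1 + Real.sqrt 2) ^ (2 * j) ≤ (1 + Real.sqrt 2) ^ (2 * N) / 4 := by
  have h2 : (1 : ℝ) ≤ Real.sqrt 2 := by rw [Real.one_le_sqrt]; norm_num
  induction N with
  | zero => simp
  | succ n ih =>
    rw [Finset.sum_range_succ]
    have hr : 5 ≤ (1 + Real.sqrt 2) ^ 2 := by
      nlinarith [Real.sq_sqrt (show (0 : ℝ) ≤ 2 by norm_num)]
    have := mul_le_mul_of_nonneg_left hr
      (show 0 ≤ (1 + Real.sqrt 2) ^ (2 * n) by positivity)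
    rw [mul_add 2 n 1, mul_one, pow_add]
    linarith

/-- The coefficients of a polynomial of degree less than `N` are controlled by its `L²` norm on
`[-1, 1]`. -/
theorem sum_coeff_sq_le_integral (N : ℕ) (p : ℝ[X]) (hp : p.degree < N) :
    ∑ k ∈ Finset.range N, p.coeff k ^ 2 ≤
      (1 + Real.sqrt 2) ^ (2 * N) * (1 / 2 * ∫ x in (-1 : ℝ)..1, (p.eval x) ^ 2) := by
  obtain ⟨b, hb⟩ := exists_eq_sum_U N p hp
  have hint := sum_sq_le_integral_sum_U_sq N b
  rw [← hb] at hint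
  set B := ∑ j ∈ Finset.range N, b j ^ 2 with hB
  have hB0 : 0 ≤ B := Finset.sum_nonneg fun j _ => sq_nonneg _
  have hU : ∀ j : ℕ, ∑ k ∈ Finset.range N, (U ℝ (j : ℤ)).coeff k ^ 2 ≤
      (1 + Real.sqrt 2) ^ (2 * j) := by
    intro j
    calc _ = ∑ k ∈ Finset.range N, |(U ℝ (j : ℤ)).coeff k| ^ 2 := by simp only [sq_abs]
      _ ≤ (∑ k ∈ Finset.range N, |(U ℝ (j : ℤ)).coeff k|) ^ 2 :=
        Finset.sum_sq_le_sq_sum_of_nonneg fun _ _ => abs_nonneg _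
      _ ≤ ((1 + Real.sqrt 2) ^ j) ^ 2 := by
        gcongr
        exact sum_abs_coeff_U_le N j
      _ = _ := by rw [← pow_mul, mul_comm]
  have hcoeff : ∀ k, p.coeff k ^ 2 ≤
      B * ∑ j ∈ Finset.range N, (U ℝ (j : ℤ)).coeff k ^ 2 := by
    intro k
    rw [hb, finsetSum_coeff]
    simp_rw [coeff_C_mul]
    exact Finset.sum_mul_sq_le_sq_mul_sq _ _ _
  calc _ ≤ ∑ k ∈ Finset.range N, B * ∑ j ∈ Finset.range N, (U ℝ (j : ℤ)).coeff k ^ 2 :=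
        Finset.sum_le_sum fun k _ => hcoeff k
    _ = B * ∑ j ∈ Finset.range N, ∑ k ∈ Finset.range N, (U ℝ (j : ℤ)).coeff k ^ 2 := by
        rw [← Finset.mul_sum, Finset.sum_comm]
    _ ≤ B * ((1 + Real.sqrt 2) ^ (2 * N) / 4) := by
        gcongr
        exact (Finset.sum_le_sum fun j _ => hU j).trans (sum_pow_le N)
    _ = (1 + Real.sqrt 2) ^ (2 * N) * (1 / 2 * (B / 2)) := by ring
    _ ≤ _ := by
        gcongr
        nlinarith [Real.pi_gt_three]

open Matrix in
theorem dotProduct_HmatN_mulVec (N : ℕ) (c : Fin N → ℝ) :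
    c ⬝ᵥ (HmatN N *ᵥ c) =
      1 / 2 * ∫ x in (-1 : ℝ)..1, (∑ k : Fin N, c k * x ^ (k : ℕ)) ^ 2 := by
  have h : ∀ x : ℝ, (∑ k : Fin N, c k * x ^ (k : ℕ)) ^ 2 =
      ∑ k : Fin N, ∑ l : Fin N, c k * c l * x ^ ((k : ℕ) + (l : ℕ)) := by
    intro x
    rw [sq, Finset.sum_mul_sum]
    exact Finset.sum_congr rfl fun k _ => Finset.sum_congr rfl fun l _ => by ring
  simp_rw [h]
  rw [intervalIntegral.integral_finsetSum
    fun k _ => Continuous.intervalIntegrable (by fun_prop) _ _, dotProduct, Finset.mul_sum]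
  refine Finset.sum_congr rfl fun k _ => ?_
  rw [intervalIntegral.integral_finsetSum
    fun l _ => Continuous.intervalIntegrable (by fun_prop) _ _, mulVec, dotProduct,
    Finset.mul_sum, Finset.mul_sum]
  refine Finset.sum_congr rfl fun l _ => ?_
  rw [intervalIntegral.integral_const_mul, HmatN, of_apply]
  ring

open Matrix in
/-- The quadratic form of `Ĥ_N` is bounded below by `(1 + √2)^{-2N}`. -/
theorem dotProduct_self_le_HmatN (N : ℕ) (c : Fin N → ℝ) :
    c ⬝ᵥ c ≤ (1 + Real.sqrt 2) ^ (2 * N) * (c ⬝ᵥ (HmatN N *ᵥ c)) := by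
  set p : ℝ[X] := ∑ k : Fin N, C (c k) * X ^ (k : ℕ) with hp
  have hdeg : p.degree < N := degree_sum_fin_lt c
  have hcoeff : ∀ k : Fin N, p.coeff k = c k := by
    intro k
    simp [hp, coeff_X_pow, Fin.val_inj]
  have heval : ∀ x, p.eval x = ∑ k : Fin N, c k * x ^ (k : ℕ) := by
    intro x
    simp [hp, eval_finsetSum]
  have h := sum_coeff_sq_le_integral N p hdeg
  rw [Finset.sum_range] at h
  simp_rw [hcoeff, heval] at h
  rw [dotProduct_HmatN_mulVec]
  simpa only [dotProduct, sq] using h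

theorem HmatN_posDef (N : ℕ) : (HmatN N).PosDef := by
  refine Matrix.PosDef.of_dotProduct_mulVec_pos ?_ fun c hc => ?_
  · ext k l
    simp [HmatN, add_comm]
  · have h := dotProduct_self_le_HmatN N c
    have h0 : 0 < c ⬝ᵥ c := by simpa using Matrix.dotProduct_star_self_pos_iff.mpr hc
    rw [star_trivial]
    exact pos_of_mul_pos_right (h0.trans_le h) (by positivity)

/-- `Ĥ_N` is positive definite (hence invertible), and its inverse has spectral
norm at most `C (1+√2)^{2N}` with `C` independent of `N`
(Lemma 9 of the paper, second part). -/
theorem HmatN_posDef_and_inverse_bound :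
    (∀ N : ℕ, (HmatN N).PosDef) ∧
    (∀ N : ℕ, IsUnit (HmatN N)) ∧
    ∃ C > (0 : ℝ), ∀ N : ℕ, ∀ v : EuclideanSpace ℝ (Fin N),
      ‖Matrix.toEuclideanLin (HmatN N)⁻¹ v‖ ≤
        C * (1 + Real.sqrt 2) ^ (2 * N) * ‖v‖ := by
  refine ⟨HmatN_posDef, fun N => (HmatN_posDef N).isUnit, 1, one_pos, fun N v => ?_⟩
  set w := Matrix.toEuclideanLin (HmatN N)⁻¹ v with hw
  have hdet : IsUnit (HmatN N).det :=
    (Matrix.isUnit_iff_isUnit_det _).mp (HmatN_posDef N).isUnit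
  have hHw : Matrix.mulVec (HmatN N) w.ofLp = v.ofLp := by
    rw [hw, Matrix.ofLp_toLpLin, Matrix.toLin'_apply, Matrix.mulVec_mulVec,
      Matrix.mul_nonsing_inv _ hdet, Matrix.one_mulVec]
  have h := dotProduct_self_le_HmatN N w.ofLp
  have hww : w.ofLp ⬝ᵥ w.ofLp = ‖w‖ * ‖w‖ := by
    rw [← real_inner_self_eq_norm_mul_norm, EuclideanSpace.inner_eq_star_dotProduct, star_trivial]
  have hwv : w.ofLp ⬝ᵥ v.ofLp ≤ ‖w‖ * ‖v‖ := by
    have := real_inner_le_norm v w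
    rwa [EuclideanSpace.inner_eq_star_dotProduct, star_trivial, mul_comm] at this
  rw [hHw, hww] at h
  rcases (norm_nonneg w).eq_or_lt with h0 | h0
  · rw [← h0]; positivity
  · refine le_of_mul_le_mul_left ?_ h0
    calc _ ≤ (1 + Real.sqrt 2) ^ (2 * N) * (w.ofLp ⬝ᵥ v.ofLp) := h
      _ ≤ (1 + Real.sqrt 2) ^ (2 * N) * (‖w‖ * ‖v‖) := by gcongr
      _ = _ := by ring
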